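/- arXiv:1805.06755 — 2 statements merged into one kernel-verified Lean document; each statement's English description precedes it below -/
import Mathlib

section
/- Let a, β, ν be real numbers with β > 0 and ν > 0. Then ∫_0^∞ cos(ax)/(cosh(βx))^ν dx = (2^{ν−2}/(β·Γ(ν))) · ‖Γ_ℂ(ν/2 + (a/(2β))·i)‖², where Γ_ℂ is the complex Gamma function and ‖·‖ is the complex absolute value. Equivalently, the integral equals (2^{ν−2}/(β·Γ(ν))) · Γ_ℂ(ν/2 + ia/(2β))·Γ_ℂ(ν/2 − ia/(2β)). -/
open MeasureTheory

/-- The logistic function in exponential form, in terms of `cosh`. -/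
lemma sigmoid_two_mul (y : ℝ) :
    Real.sigmoid (2 * y) = Real.exp (y - Real.log (2 * Real.cosh y)) := by
  have hc : 0 < 2 * Real.cosh y := by positivity
  rw [Real.exp_sub, Real.exp_log hc, Real.sigmoid_def, Real.cosh_eq, mul_div_cancel₀ _ two_ne_zero,
    inv_eq_one_div, div_eq_div_iff (by positivity) (by positivity), one_mul, mul_add, mul_one,
    ← Real.exp_add]
  ring_nf

lemma one_sub_sigmoid_two_mul (y : ℝ) :
    1 - Real.sigmoid (2 * y) = Real.exp (-y - Real.log (2 * Real.cosh y)) := by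
  rw [← Real.sigmoid_neg, ← mul_neg, sigmoid_two_mul, Real.cosh_neg]

lemma ofReal_exp_cpow (r : ℝ) (w : ℂ) : ((Real.exp r : ℝ) : ℂ) ^ w = Complex.exp (r * w) := by
  rw [Complex.cpow_def_of_ne_zero (by exact_mod_cast (Real.exp_pos r).ne'),
    ← Complex.ofReal_log (Real.exp_pos r).le, Real.log_exp]

/-- The beta integrand after the substitution `t = sigmoid (2 * y)`. -/
lemma sigmoid_beta_integrand (y : ℝ) (u v : ℂ) :
    (Real.sigmoid (2 * y) * (1 - Real.sigmoid (2 * y)) : ℝ) •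
        ((Real.sigmoid (2 * y) : ℂ) ^ (u - 1) * (1 - (Real.sigmoid (2 * y) : ℂ)) ^ (v - 1))
      = Complex.exp (y * (u - v) - Real.log (2 * Real.cosh y) * (u + v)) := by
  have h1 : (1 - (Real.sigmoid (2 * y) : ℂ)) = ((1 - Real.sigmoid (2 * y) : ℝ) : ℂ) := by
    push_cast; rfl
  rw [h1, one_sub_sigmoid_two_mul, sigmoid_two_mul, ofReal_exp_cpow, ofReal_exp_cpow,
    Complex.real_smul, Complex.ofReal_mul, Complex.ofReal_exp, Complex.ofReal_exp,
    ← Complex.exp_add, ← Complex.exp_add, ← Complex.exp_add]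
  congr 1
  push_cast
  ring

lemma re_exp_eq_cos_div_cosh_rpow (a β ν x : ℝ) (hβ : 0 < β) :
    (Complex.exp ((β * x : ℝ) * (2 * ((a / (2 * β) : ℝ) * Complex.I))
      - Real.log (2 * Real.cosh (β * x)) * (ν : ℂ))).re
      = (2 : ℝ) ^ (-ν) * (Real.cos (a * x) / (Real.cosh (β * x)) ^ ν) := by
  have hc : 0 < Real.cosh (β * x) := Real.cosh_pos _
  have h : ((β * x : ℝ) * (2 * ((a / (2 * β) : ℝ) * Complex.I))
      - Real.log (2 * Real.cosh (β * x)) * (ν : ℂ))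
      = ((Real.log (2 * Real.cosh (β * x)) * (-ν) : ℝ) : ℂ) + (a * x : ℝ) * Complex.I := by
    have : (β : ℂ) ≠ 0 := by exact_mod_cast hβ.ne'
    push_cast
    field_simp
    ring
  rw [h, Complex.exp_re]
  simp only [Complex.add_re, Complex.add_im, Complex.ofReal_re, Complex.ofReal_im,
    Complex.re_ofReal_mul, Complex.im_ofReal_mul, Complex.I_re, Complex.I_im, mul_zero, mul_one,
    add_zero, zero_add]
  rw [← Real.rpow_def_of_pos (by positivity), Real.mul_rpow zero_le_two hc.le,
    Real.rpow_neg hc.le]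
  ring

lemma image_sigmoid_mul {c : ℝ} (hc : 0 < c) :
    (fun x : ℝ => Real.sigmoid (c * x)) '' Set.univ = Set.Ioo 0 1 := by
  rw [Set.image_univ, ← Real.range_sigmoid]
  exact (mul_left_surjective₀ hc.ne').range_comp Real.sigmoid

theorem stmt_10 (a β ν : ℝ) (hβ : 0 < β) (hν : 0 < ν) :
    ∫ x in Set.Ioi (0 : ℝ), Real.cos (a * x) / (Real.cosh (β * x)) ^ ν
    = (2 : ℝ) ^ (ν - 2) / (β * Real.Gamma ν) *
        ‖Complex.Gamma ((ν / 2 : ℝ) + (a / (2 * β) : ℝ) * Complex.I)‖ ^ 2 := by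
  set u : ℂ := (ν / 2 : ℝ) + (a / (2 * β) : ℝ) * Complex.I with hu
  set v : ℂ := (starRingEnd ℂ) u with hv
  have hu0 : 0 < u.re := by
    rw [hu, Complex.add_re, Complex.ofReal_re, Complex.re_ofReal_mul, Complex.I_re]
    linarith
  have hv0 : 0 < v.re := by simpa [hv] using hu0
  have hvu : v = (ν / 2 : ℝ) - (a / (2 * β) : ℝ) * Complex.I := by
    rw [hv, hu, map_add, map_mul, Complex.conj_ofReal, Complex.conj_ofReal, Complex.conj_I]
    ring
  have huv : u + v = ν := by rw [hvu, hu]; push_cast; ring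
  have huv' : u - v = 2 * ((a / (2 * β) : ℝ) * Complex.I) := by rw [hvu, hu]; ring
  have hB : ‖Complex.Gamma u‖ ^ 2 = Real.Gamma ν * (Complex.betaIntegral u v).re := by
    have h := Complex.Gamma_mul_Gamma_eq_betaIntegral hu0 hv0
    rw [huv, hv, Complex.Gamma_conj, Complex.mul_conj, Complex.Gamma_ofReal] at h
    rw [← Complex.normSq_eq_norm_sq, ← Complex.re_ofReal_mul, ← h, Complex.ofReal_re]
  set g : ℝ → ℂ := fun t => (t : ℂ) ^ (u - 1) * (1 - (t : ℂ)) ^ (v - 1) with hg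
  set σ : ℝ → ℝ := fun x => Real.sigmoid (2 * β * x) with hσ
  set d : ℝ → ℝ := fun x =>
    Real.sigmoid (2 * β * x) * (1 - Real.sigmoid (2 * β * x)) * (2 * β) with hd
  have hderiv : ∀ x ∈ Set.univ, HasDerivWithinAt σ (d x) Set.univ x := fun x _ =>
    ((Real.hasDerivAt_sigmoid (2 * β * x)).comp x
      (by simpa using (hasDerivAt_id x).const_mul (2 * β))).hasDerivWithinAt
  have hinj : Set.InjOn σ Set.univ := fun x _ y _ h =>
    mul_left_cancel₀ (by positivity : (2 * β) ≠ 0) (Real.sigmoid_injective h)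
  have himg : σ '' Set.univ = Set.Ioo 0 1 := image_sigmoid_mul (by positivity)
  have hpt : ∀ x, (|d x| • g (σ x)).re
      = 2 * β * 2 ^ (-ν) * (Real.cos (a * x) / (Real.cosh (β * x)) ^ ν) := by
    intro x
    have hd0 : |d x| = 2 * β *
        (Real.sigmoid (2 * (β * x)) * (1 - Real.sigmoid (2 * (β * x)))) := by
      rw [abs_of_nonneg, hd]
      · ring_nf
      · have h1 := Real.sigmoid_nonneg (2 * β * x)
        have h2 := sub_nonneg.2 (Real.sigmoid_le_one (2 * β * x))
        positivity
    rw [hd0, mul_smul, hg, hσ]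
    simp only [mul_assoc 2 β x]
    rw [sigmoid_beta_integrand, huv, huv', Complex.smul_re, re_exp_eq_cos_div_cosh_rpow a β ν x hβ,
      smul_eq_mul]
    ring
  have hgint : IntegrableOn g (Set.Ioo 0 1) := by
    have h := Complex.betaIntegral_convergent hu0 hv0
    rwa [intervalIntegrable_iff_integrableOn_Ioo_of_le zero_le_one] at h
  have hfint : Integrable fun x => |d x| • g (σ x) := by
    rw [← integrableOn_univ,
      ← integrableOn_image_iff_integrableOn_abs_deriv_smul MeasurableSet.univ hderiv hinj, himg]
    exact hgint
  have hbeta : (Complex.betaIntegral u v).re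
      = 2 * β * 2 ^ (-ν) * ∫ x : ℝ, Real.cos (a * x) / (Real.cosh (β * x)) ^ ν := by
    rw [Complex.betaIntegral, intervalIntegral.integral_of_le zero_le_one,
      integral_Ioc_eq_integral_Ioo, ← himg,
      integral_image_eq_integral_abs_deriv_smul MeasurableSet.univ hderiv hinj,
      Measure.restrict_univ, ← integral_const_mul]
    simp only [← hpt]
    exact (integral_re hfint).symm
  have heven : ∫ x : ℝ, Real.cos (a * x) / (Real.cosh (β * x)) ^ ν
      = 2 * ∫ x in Set.Ioi (0 : ℝ), Real.cos (a * x) / (Real.cosh (β * x)) ^ ν := by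
    rw [← integral_comp_abs]
    congr 1 with x
    rcases abs_choice x with h | h <;> simp [h]
  have hΓ : Real.Gamma ν ≠ 0 := (Real.Gamma_pos_of_pos hν).ne'
  rw [hB, hbeta, heven, Real.rpow_sub two_pos, Real.rpow_neg zero_le_two]
  have h2 : (2 : ℝ) ^ ν ≠ 0 := by positivity
  rw [Real.rpow_two]
  generalize ∫ x in Set.Ioi (0 : ℝ), Real.cos (a * x) / (Real.cosh (β * x)) ^ ν = J
  field_simp
end

section
/- Let a and β be real numbers with a > 0 and β > 0. Then ∫_0^∞ cos(ax)/(cosh(βx))² dx = (π·a)/(2β²·sinh(πa/(2β))). -/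
open MeasureTheory

/-- The substitution `t = sigmoid y` sends the integrand of the Beta function to
`sigmoid y ^ u * sigmoid (-y) ^ v`. -/
theorem sigmoid_deriv_smul_betaIntegrand (u v : ℂ) (y : ℝ) :
    |Real.sigmoid y * (1 - Real.sigmoid y)| •
      ((Real.sigmoid y : ℂ) ^ (u - 1) * (1 - (Real.sigmoid y : ℂ)) ^ (v - 1)) =
    (Real.sigmoid y : ℂ) ^ u * (Real.sigmoid (-y) : ℂ) ^ v := by
  have h1 : (Real.sigmoid y : ℂ) ≠ 0 := by exact_mod_cast (Real.sigmoid_pos y).ne'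
  have h2 : (Real.sigmoid (-y) : ℂ) ≠ 0 := by exact_mod_cast (Real.sigmoid_pos (-y)).ne'
  have h3 : (1 - (Real.sigmoid y : ℂ)) = (Real.sigmoid (-y) : ℂ) := by
    rw [Real.sigmoid_neg]; push_cast; rfl
  rw [h3, ← Real.sigmoid_neg, abs_of_pos (mul_pos (Real.sigmoid_pos y) (Real.sigmoid_pos (-y))),
    Complex.cpow_sub _ _ h1, Complex.cpow_sub _ _ h2, Complex.cpow_one, Complex.cpow_one,
    Complex.real_smul]
  push_cast
  field_simp

theorem integrable_sigmoid_cpow_mul_cpow {u v : ℂ} (hu : 0 < u.re) (hv : 0 < v.re) :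
    Integrable fun y : ℝ ↦ (Real.sigmoid y : ℂ) ^ u * (Real.sigmoid (-y) : ℂ) ^ v := by
  have h := Complex.betaIntegral_convergent hu hv
  rw [intervalIntegrable_iff_integrableOn_Ioo_of_le zero_le_one, ← Real.range_sigmoid,
    ← Set.image_univ, integrableOn_image_iff_integrableOn_abs_deriv_smul MeasurableSet.univ
      (fun x _ ↦ (Real.hasDerivAt_sigmoid x).hasDerivWithinAt) Real.sigmoid_injective.injOn,
    integrableOn_univ] at h
  simpa only [sigmoid_deriv_smul_betaIntegrand] using h

theorem integral_sigmoid_cpow_mul_cpow (u v : ℂ) :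
    ∫ y : ℝ, (Real.sigmoid y : ℂ) ^ u * (Real.sigmoid (-y) : ℂ) ^ v = u.betaIntegral v := by
  rw [Complex.betaIntegral, intervalIntegral.integral_of_le zero_le_one,
    integral_Ioc_eq_integral_Ioo, ← Real.range_sigmoid, ← Set.image_univ,
    integral_image_eq_integral_abs_deriv_smul MeasurableSet.univ
      (fun x _ ↦ (Real.hasDerivAt_sigmoid x).hasDerivWithinAt) Real.sigmoid_injective.injOn,
    setIntegral_univ]
  simp only [sigmoid_deriv_smul_betaIntegrand]

theorem betaIntegral_one_add_one_sub {z : ℂ} (hz : z ≠ 0) (h : z.re = 0) :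
    Complex.betaIntegral (1 + z) (1 - z) = Real.pi * z / Complex.sin (Real.pi * z) := by
  have hG := Complex.Gamma_mul_Gamma_eq_betaIntegral (s := 1 + z) (t := 1 - z)
    (by simp [h]) (by simp [h])
  have h2 : Complex.Gamma (1 + z + (1 - z)) = 1 := by
    rw [show 1 + z + (1 - z) = ((1 : ℕ) : ℂ) + 1 by push_cast; ring, Complex.Gamma_nat_eq_factorial]
    simp
  rw [h2, one_mul, add_comm, Complex.Gamma_add_one z hz, mul_assoc,
    Complex.Gamma_mul_Gamma_one_sub] at hG
  rw [add_comm, ← hG]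
  ring

theorem sigmoid_mul_sigmoid_neg (y : ℝ) :
    Real.sigmoid y * Real.sigmoid (-y) = 1 / (4 * Real.cosh (y / 2) ^ 2) := by
  have hy : Real.exp y = Real.exp (y / 2) ^ 2 := by rw [← Real.exp_nat_mul]; congr 1; push_cast; ring
  have := Real.exp_pos (y / 2)
  rw [Real.sigmoid_def, Real.sigmoid_def, neg_neg, Real.cosh_eq, Real.exp_neg, Real.exp_neg, hy]
  field_simp
  ring

theorem sigmoid_cpow_mul_cpow_one_add_one_sub (s y : ℝ) :
    (Real.sigmoid y : ℂ) ^ (1 + s * Complex.I) * (Real.sigmoid (-y) : ℂ) ^ (1 - s * Complex.I) =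
    ((1 / (4 * Real.cosh (y / 2) ^ 2) : ℝ) : ℂ) * Complex.exp ((s * y : ℝ) * Complex.I) := by
  have h1 : (Real.sigmoid y : ℂ) ≠ 0 := by exact_mod_cast (Real.sigmoid_pos y).ne'
  have h2 : (Real.sigmoid (-y) : ℂ) ≠ 0 := by exact_mod_cast (Real.sigmoid_pos (-y)).ne'
  have hlog : Real.log (Real.sigmoid (-y)) = Real.log (Real.sigmoid y) - y := by
    rw [← Real.sigmoid_mul_rexp_neg, Real.log_mul (Real.sigmoid_pos y).ne' (Real.exp_ne_zero _),
      Real.log_exp]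
    ring
  rw [← sigmoid_mul_sigmoid_neg, Complex.cpow_add _ _ h1, Complex.cpow_sub _ _ h2,
    Complex.cpow_one, Complex.cpow_one, Complex.cpow_def_of_ne_zero h1,
    Complex.cpow_def_of_ne_zero h2, ← Complex.ofReal_log (Real.sigmoid_pos y).le,
    ← Complex.ofReal_log (Real.sigmoid_pos (-y)).le, hlog,
    show ((s * y : ℝ) : ℂ) * Complex.I = Real.log (Real.sigmoid y) * (s * Complex.I) -
      ((Real.log (Real.sigmoid y) - y : ℝ) : ℂ) * (s * Complex.I) by push_cast; ring,
    Complex.exp_sub]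
  push_cast
  ring

theorem integral_cos_div_four_mul_cosh_sq {s : ℝ} (hs : s ≠ 0) :
    ∫ y : ℝ, Real.cos (s * y) / (4 * Real.cosh (y / 2) ^ 2) =
      Real.pi * s / Real.sinh (Real.pi * s) := by
  have hint := integrable_sigmoid_cpow_mul_cpow (u := 1 + s * Complex.I) (v := 1 - s * Complex.I)
    (by simp) (by simp)
  have hval := integral_sigmoid_cpow_mul_cpow (1 + s * Complex.I) (1 - s * Complex.I)
  have hsinh : Complex.sin (Real.pi * (s * Complex.I)) =
      (Real.sinh (Real.pi * s) : ℝ) * Complex.I := by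
    rw [← mul_assoc, Complex.sin_mul_I]; push_cast; rfl
  rw [betaIntegral_one_add_one_sub (by simp [hs]) (by simp), hsinh, ← mul_assoc,
    mul_div_mul_right _ _ Complex.I_ne_zero] at hval
  have hre := integral_re hint
  rw [hval] at hre
  simp only [sigmoid_cpow_mul_cpow_one_add_one_sub, RCLike.re_eq_complex_re, Complex.re_ofReal_mul,
    Complex.exp_ofReal_mul_I_re] at hre
  simp only [div_eq_mul_one_div (Real.cos _), mul_comm (Real.cos _), hre]
  norm_cast

theorem stmt_18 (a β : ℝ) (ha : 0 < a) (hβ : 0 < β) :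
    ∫ x in Set.Ioi (0 : ℝ), Real.cos (a * x) / (Real.cosh (β * x)) ^ 2
    = Real.pi * a / (2 * β ^ 2 * Real.sinh (Real.pi * a / (2 * β))) := by
  have hs : a / (2 * β) ≠ 0 := by positivity
  have habs := integral_comp_abs (f := fun x ↦ Real.cos (a * x) / Real.cosh (β * x) ^ 2)
  have heven (x : ℝ) : Real.cos (a * |x|) / Real.cosh (β * |x|) ^ 2 =
      4 * (Real.cos (a / (2 * β) * (2 * β * x)) / (4 * Real.cosh (2 * β * x / 2) ^ 2)) := by
    rw [show a / (2 * β) * (2 * β * x) = a * x by field_simp,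
      show 2 * β * x / 2 = β * x by ring, ← Real.cos_abs (a * x), ← Real.cosh_abs (β * x),
      abs_mul, abs_mul, abs_of_pos ha, abs_of_pos hβ]
    field_simp
  simp only [heven] at habs
  rw [integral_const_mul, Measure.integral_comp_mul_left
    (fun y ↦ Real.cos (a / (2 * β) * y) / (4 * Real.cosh (y / 2) ^ 2)) (2 * β),
    integral_cos_div_four_mul_cosh_sq hs, abs_of_pos (by positivity), smul_eq_mul,
    ← mul_div_assoc Real.pi] at habs
  have hsinh : 0 < Real.sinh (Real.pi * a / (2 * β)) := Real.sinh_pos_iff.2 (by positivity)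
  rw [← mul_right_inj' (two_ne_zero (α := ℝ)), ← habs]
  field_simp
  norm_num
end
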